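/- Let M > 0 and let r : ℝ² → ℝ be a Schwarzschild double-null radius function with associated background quantities Ω², ω, κ, ρ. Let W, W̲, N, N̲, ϖ, P : ℝ² → ℝ be a smooth solution of the spherically symmetric linearised vacuum Einstein system in double null gauge. With f₁ := −Ω²·(ω² + (5/4)·Ω²·ρ), f₂ := −(3/4)·Ω⁴·ρ, f₃ := 2Ω²·(Ω²·ρ − ω²), define Ḟ_u(v₀,v₁) := ∫_{v₀}^{v₁} r²·( (3/2)·Ω⁴·P² − (f₃/Ω²)·N·W̲ + (2/Ω²)·(ω·f₃ + 2κ·f₂)·ϖ·W − (f₁/(2Ω²))·W² − (f₂/(2Ω²))·(W̲ + 2κϖ)² )(u,v) dv and Ḟ̲_v(u₀,u₁) := ∫_{u₀}^{u₁} r²·( (3/2)·Ω⁴·P² − (f₃/Ω²)·N̲·W − (2/Ω²)·(ω·f₃ + 2κ·f₂)·ϖ·W̲ − (f₁/(2Ω²))·W̲² − (f₂/(2Ω²))·(W − 2κϖ)² )(u,v) du. Then for all real u₀, u₁, v₀, v₁: Ḟ_{u₁}(v₀,v₁) + Ḟ̲_{v₁}(u₀,u₁) = Ḟ_{u₀}(v₀,v₁)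 + Ḟ̲_{v₀}(u₀,u₁). (This is the spherically symmetric case of the conservation law (1.21) of Theorem 1.5, the new conservation law associated with the Teukolsky null curvature components, on a characteristic rectangle of the Schwarzschild exterior.) -/

import Mathlib

open MeasureTheory Filter Set

/-- Partial derivative in the first (u) variable. -/
noncomputable def pdu (f : ℝ → ℝ → ℝ) (u v : ℝ) : ℝ := deriv (fun x => f x v) u

/-- Partial derivative in the second (v) variable. -/
noncomputable def pdv (f : ℝ → ℝ → ℝ) (u v : ℝ) : ℝ := deriv (fun y => f u y) v

/-- Schwarzschild double-null radius function: smooth, `r > 2M`,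
`∂r/∂v = 1 − 2M/r`, `∂r/∂u = −(1 − 2M/r)`. -/
def IsSchwRadius (M : ℝ) (r : ℝ → ℝ → ℝ) : Prop :=
  ContDiff ℝ (⊤ : ℕ∞) (Function.uncurry r) ∧
  (∀ u v, 2 * M < r u v) ∧
  (∀ u v, pdv r u v = 1 - 2 * M / r u v) ∧
  (∀ u v, pdu r u v = -(1 - 2 * M / r u v))

/-- Background lapse squared `Ω² = 1 − 2M/r`. -/
noncomputable def Om2 (M : ℝ) (r : ℝ → ℝ → ℝ) (u v : ℝ) : ℝ := 1 - 2 * M / r u v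

/-- Background `ω = M/r²`. -/
noncomputable def om (M : ℝ) (r : ℝ → ℝ → ℝ) (u v : ℝ) : ℝ := M / (r u v) ^ 2

/-- Background `κ = 2Ω²/r = Ω tr χ`. -/
noncomputable def kap (M : ℝ) (r : ℝ → ℝ → ℝ) (u v : ℝ) : ℝ := 2 * Om2 M r u v / r u v

/-- Background curvature `ρ = −2M/r³`. -/
noncomputable def rho (M : ℝ) (r : ℝ → ℝ → ℝ) (u v : ℝ) : ℝ := -(2 * M) / (r u v) ^ 3

/-- A smooth solution `(W, W̲, N, N̲, ϖ, P)` of the spherically symmetric linearised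
vacuum Einstein system in double null gauge on the Schwarzschild exterior. -/
def IsLinSolution (M : ℝ) (r W Wb N Nb pp P : ℝ → ℝ → ℝ) : Prop :=
  ContDiff ℝ (⊤ : ℕ∞) (Function.uncurry W) ∧
  ContDiff ℝ (⊤ : ℕ∞) (Function.uncurry Wb) ∧
  ContDiff ℝ (⊤ : ℕ∞) (Function.uncurry N) ∧
  ContDiff ℝ (⊤ : ℕ∞) (Function.uncurry Nb) ∧
  ContDiff ℝ (⊤ : ℕ∞) (Function.uncurry pp) ∧
  ContDiff ℝ (⊤ : ℕ∞) (Function.uncurry P) ∧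
  (∀ u v, pdv W u v = (2 * om M r u v - kap M r u v) * W u v + 2 * kap M r u v * N u v) ∧
  (∀ u v, pdu Wb u v = (kap M r u v - 2 * om M r u v) * Wb u v - 2 * kap M r u v * Nb u v) ∧
  (∀ u v, pdv Wb u v =
    2 * Om2 M r u v * (P u v + 2 * rho M r u v * pp u v)
      - (kap M r u v / 2) * (Wb u v - W u v)) ∧
  (∀ u v, pdu W u v =
    2 * Om2 M r u v * (P u v + 2 * rho M r u v * pp u v)
      - (kap M r u v / 2) * (Wb u v - W u v)) ∧
  (∀ u v, pdv Nb u v = -(Om2 M r u v) * (2 * rho M r u v * pp u v + P u v)) ∧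
  (∀ u v, pdu N u v = -(Om2 M r u v) * (2 * rho M r u v * pp u v + P u v)) ∧
  (∀ u v, pdu pp u v = Nb u v) ∧
  (∀ u v, pdv pp u v = N u v) ∧
  (∀ u v, pdv P u v = -(3 / 2) * (kap M r u v * P u v + rho M r u v * W u v)) ∧
  (∀ u v, pdu P u v = (3 / 2) * (kap M r u v * P u v - rho M r u v * Wb u v))

/-- `f₁ = −Ω²(ω² + (5/4)Ω²ρ)`. -/
noncomputable def f1 (M : ℝ) (r : ℝ → ℝ → ℝ) (u v : ℝ) : ℝ :=
  -(Om2 M r u v) * ((om M r u v) ^ 2 + (5 / 4) * Om2 M r u v * rho M r u v)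

/-- `f₂ = −(3/4)Ω⁴ρ`. -/
noncomputable def f2 (M : ℝ) (r : ℝ → ℝ → ℝ) (u v : ℝ) : ℝ :=
  -(3 / 4) * (Om2 M r u v) ^ 2 * rho M r u v

/-- `f₃ = 2Ω²(Ω²ρ − ω²)`. -/
noncomputable def f3 (M : ℝ) (r : ℝ → ℝ → ℝ) (u v : ℝ) : ℝ :=
  2 * Om2 M r u v * (Om2 M r u v * rho M r u v - (om M r u v) ^ 2)

/-- Teukolsky-type flux density along the outgoing cones (integrand of `Ḟ_u[ℛ]`):
`Ġ = r²((3/2)Ω⁴P² − (f₃/Ω²)NW̲ + (2/Ω²)(ωf₃ + 2κf₂)ϖW − (f₁/2Ω²)W² − (f₂/2Ω²)(W̲ + 2κϖ)²)`. -/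
noncomputable def Gdot (M : ℝ) (r W Wb N pp P : ℝ → ℝ → ℝ) (u v : ℝ) : ℝ :=
  (r u v) ^ 2 *
    ((3 / 2) * (Om2 M r u v) ^ 2 * (P u v) ^ 2
      - (f3 M r u v / Om2 M r u v) * N u v * Wb u v
      + (2 / Om2 M r u v) * (om M r u v * f3 M r u v + 2 * kap M r u v * f2 M r u v)
          * pp u v * W u v
      - (f1 M r u v / (2 * Om2 M r u v)) * (W u v) ^ 2
      - (f2 M r u v / (2 * Om2 M r u v)) * (Wb u v + 2 * kap M r u v * pp u v) ^ 2)

/-- Teukolsky-type flux density along the ingoing cones (integrand of `Ḟ_v[ℛ]`):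
`Ġ̲ = r²((3/2)Ω⁴P² − (f₃/Ω²)N̲W − (2/Ω²)(ωf₃ + 2κf₂)ϖW̲ − (f₁/2Ω²)W̲² − (f₂/2Ω²)(W − 2κϖ)²)`. -/
noncomputable def Gbdot (M : ℝ) (r W Wb Nb pp P : ℝ → ℝ → ℝ) (u v : ℝ) : ℝ :=
  (r u v) ^ 2 *
    ((3 / 2) * (Om2 M r u v) ^ 2 * (P u v) ^ 2
      - (f3 M r u v / Om2 M r u v) * Nb u v * W u v
      - (2 / Om2 M r u v) * (om M r u v * f3 M r u v + 2 * kap M r u v * f2 M r u v)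
          * pp u v * Wb u v
      - (f1 M r u v / (2 * Om2 M r u v)) * (Wb u v) ^ 2
      - (f2 M r u v / (2 * Om2 M r u v)) * (W u v - 2 * kap M r u v * pp u v) ^ 2)

/-- A continuously differentiable planar vector field `(F, G)` with vanishing divergence has zero
flux through the boundary of every coordinate rectangle. -/
theorem rectangle_flux_of_divergence_eq_zero {F G : ℝ → ℝ → ℝ}
    (hF : ContDiff ℝ 1 (Function.uncurry F)) (hG : ContDiff ℝ 1 (Function.uncurry G))
    (hdiv : ∀ u v, pdu F u v + pdv G u v = 0) (u₀ u₁ v₀ v₁ : ℝ) :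
    (∫ v in v₀..v₁, F u₁ v) + (∫ u in u₀..u₁, G u v₁) =
      (∫ v in v₀..v₁, F u₀ v) + (∫ u in u₀..u₁, G u v₀) := by
  have dF := hF.differentiable one_ne_zero
  have dG := hG.differentiable one_ne_zero
  have hzero : (fun x : ℝ × ℝ => fderiv ℝ (Function.uncurry F) x (1, 0) +
      fderiv ℝ (Function.uncurry G) x (0, 1)) = fun _ => 0 := by
    funext ⟨u, v⟩
    have h1 : HasDerivAt (fun x => F x v) (fderiv ℝ (Function.uncurry F) (u, v) (1, 0)) u :=
      (dF (u, v)).hasFDerivAt.comp_hasDerivAt (f := fun x => (x, v)) u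
        ((hasDerivAt_id' u).prodMk (hasDerivAt_const u v))
    have h2 : HasDerivAt (fun y => G u y) (fderiv ℝ (Function.uncurry G) (u, v) (0, 1)) v :=
      (dG (u, v)).hasFDerivAt.comp_hasDerivAt (f := fun y => (u, y)) v
        ((hasDerivAt_const v u).prodMk (hasDerivAt_id' v))
    have := hdiv u v
    rwa [pdu, pdv, h1.deriv, h2.deriv] at this
  have key := integral2_divergence_prod_of_hasFDerivAt
    (Function.uncurry F) (Function.uncurry G) (fderiv ℝ (Function.uncurry F))
    (fderiv ℝ (Function.uncurry G)) u₀ v₀ u₁ v₁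
    hF.continuous.continuousOn hG.continuous.continuousOn
    (fun x _ => (dF x).hasFDerivAt) (fun x _ => (dG x).hasFDerivAt)
    (by rw [hzero]; exact integrableOn_zero)
  have hzero' : ∀ x y : ℝ, fderiv ℝ (Function.uncurry F) (x, y) (1, 0) +
      fderiv ℝ (Function.uncurry G) (x, y) (0, 1) = 0 := fun x y => congrFun hzero (x, y)
  simp only [hzero', intervalIntegral.integral_zero, Function.uncurry_apply_pair] at key
  linarith

/-- The flux density `Gdot` at a point as a polynomial in the unknowns, the area radius `r` and
its inverse `s`. -/
noncomputable def fluxPoly (M r s W Wb N pp P : ℝ) : ℝ :=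
  3 / 2 * (r - 2 * M) ^ 2 * P ^ 2 - 2 * M * (3 * M * s ^ 2 - 2 * s) * (N * Wb)
    + (4 * M ^ 2 * (3 * M * s ^ 4 - 2 * s ^ 3) + 12 * M * (s - 2 * M * s ^ 2) ^ 2) * (pp * W)
    + M * (12 * M * s ^ 2 - 5 * s) / 4 * W ^ 2
    - 3 / 4 * M * (s - 2 * M * s ^ 2) * (Wb + 4 * (s - 2 * M * s ^ 2) * pp) ^ 2

theorem Gdot_eq_fluxPoly {M : ℝ} {r : ℝ → ℝ → ℝ} (W Wb N pp P : ℝ → ℝ → ℝ) {u v : ℝ}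
    (hr0 : r u v ≠ 0) (hr : r u v - 2 * M ≠ 0) :
    Gdot M r W Wb N pp P u v =
      fluxPoly M (r u v) (r u v)⁻¹ (W u v) (Wb u v) (N u v) (pp u v) (P u v) := by
  simp only [Gdot, fluxPoly, f1, f2, f3, kap, om, rho]
  have hO : Om2 M r u v = (r u v - 2 * M) / r u v := by rw [Om2]; field_simp
  rw [hO]
  field_simp
  ring

/-- Exchanging the two null directions turns `Gbdot` into `Gdot` with the sign of `ϖ` reversed. -/
theorem Gbdot_eq_Gdot (M : ℝ) (r W Wb Nb pp P : ℝ → ℝ → ℝ) :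
    Gbdot M r W Wb Nb pp P = Gdot M r Wb W Nb (fun u v => -pp u v) P := by
  funext u v
  simp only [Gdot, Gbdot]
  ring

theorem HasDerivAt.fluxPoly {M x : ℝ} {r s W Wb N pp P : ℝ → ℝ} {r' s' W' Wb' N' pp' P' : ℝ}
    (hr : HasDerivAt r r' x) (hs : HasDerivAt s s' x) (hW : HasDerivAt W W' x)
    (hWb : HasDerivAt Wb Wb' x) (hN : HasDerivAt N N' x) (hpp : HasDerivAt pp pp' x)
    (hP : HasDerivAt P P' x) :
    HasDerivAt (fun y => fluxPoly M (r y) (s y) (W y) (Wb y) (N y) (pp y) (P y))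
      (3 * (r x - 2 * M) * r' * P x ^ 2 + 3 * (r x - 2 * M) ^ 2 * P x * P'
        - 2 * M * (6 * M * s x - 2) * s' * (N x * Wb x)
        - 2 * M * (3 * M * s x ^ 2 - 2 * s x) * (N' * Wb x + N x * Wb')
        + (4 * M ^ 2 * (12 * M * s x ^ 3 - 6 * s x ^ 2)
            + 24 * M * (s x - 2 * M * s x ^ 2) * (1 - 4 * M * s x)) * s' * (pp x * W x)
        + (4 * M ^ 2 * (3 * M * s x ^ 4 - 2 * s x ^ 3) + 12 * M * (s x - 2 * M * s x ^ 2) ^ 2)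
            * (pp' * W x + pp x * W')
        + M * (24 * M * s x - 5) / 4 * s' * W x ^ 2
        + M * (12 * M * s x ^ 2 - 5 * s x) / 2 * W x * W'
        - 3 / 4 * M * (1 - 4 * M * s x) * s' * (Wb x + 4 * (s x - 2 * M * s x ^ 2) * pp x) ^ 2
        - 3 / 2 * M * (s x - 2 * M * s x ^ 2) * (Wb x + 4 * (s x - 2 * M * s x ^ 2) * pp x)
            * (Wb' + 4 * (1 - 4 * M * s x) * s' * pp x + 4 * (s x - 2 * M * s x ^ 2) * pp')) x := by
  have hq := hs.sub ((hs.pow 2).const_mul (2 * M))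
  have h1 := (((hr.sub_const (2 * M)).pow 2).const_mul (3 / 2)).mul (hP.pow 2)
  have h2 := ((((hs.pow 2).const_mul (3 * M)).sub (hs.const_mul 2)).const_mul (2 * M)).mul
    (hN.mul hWb)
  have h3 := (((((hs.pow 4).const_mul (3 * M)).sub ((hs.pow 3).const_mul 2)).const_mul
    (4 * M ^ 2)).add ((hq.pow 2).const_mul (12 * M))).mul (hpp.mul hW)
  have h4 := (((((hs.pow 2).const_mul (12 * M)).sub (hs.const_mul 5)).const_mul M).div_const
    4).mul (hW.pow 2)
  have h5 := (hq.const_mul (3 / 4 * M)).mul ((hWb.add ((hq.const_mul 4).mul hpp)).pow 2)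
  refine ((((h1.sub h2).add h3).add h4).sub h5).congr_deriv ?_
  simp only [Pi.sub_apply, Pi.add_apply, Pi.mul_apply, Pi.pow_apply]
  push_cast
  ring

theorem contDiff_Gdot {M : ℝ} {r W Wb N pp P : ℝ → ℝ → ℝ} {n : WithTop ℕ∞}
    (hr : ContDiff ℝ n (Function.uncurry r)) (hr0 : ∀ u v, r u v ≠ 0)
    (hrM : ∀ u v, r u v - 2 * M ≠ 0) (hW : ContDiff ℝ n (Function.uncurry W))
    (hWb : ContDiff ℝ n (Function.uncurry Wb)) (hN : ContDiff ℝ n (Function.uncurry N))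
    (hpp : ContDiff ℝ n (Function.uncurry pp)) (hP : ContDiff ℝ n (Function.uncurry P)) :
    ContDiff ℝ n (Function.uncurry (Gdot M r W Wb N pp P)) := by
  have hs : ContDiff ℝ n fun x => (Function.uncurry r x)⁻¹ := hr.inv fun x => hr0 x.1 x.2
  have heq : Function.uncurry (Gdot M r W Wb N pp P) = fun x =>
      fluxPoly M (Function.uncurry r x) (Function.uncurry r x)⁻¹ (Function.uncurry W x)
        (Function.uncurry Wb x) (Function.uncurry N x) (Function.uncurry pp x)
        (Function.uncurry P x) :=
    funext fun x => Gdot_eq_fluxPoly W Wb N pp P (hr0 x.1 x.2) (hrM x.1 x.2)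
  rw [heq]
  simp only [fluxPoly]
  fun_prop

theorem hasDerivAt_pdu {f : ℝ → ℝ → ℝ} (hf : Differentiable ℝ (Function.uncurry f)) (u v : ℝ) :
    HasDerivAt (fun x => f x v) (pdu f u v) u := by
  have : Differentiable ℝ fun x => Function.uncurry f (x, v) := by fun_prop
  exact (this u).hasDerivAt

theorem hasDerivAt_pdv {f : ℝ → ℝ → ℝ} (hf : Differentiable ℝ (Function.uncurry f)) (u v : ℝ) :
    HasDerivAt (fun y => f u y) (pdv f u v) v := by
  have : Differentiable ℝ fun y => Function.uncurry f (u, y) := by fun_prop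
  exact (this v).hasDerivAt

/-- The pointwise conservation law `∂ᵤ Gdot + ∂ᵥ Gbdot = 0`. -/
theorem pdu_Gdot_add_pdv_Gbdot {M : ℝ} (hM : 0 < M) {r W Wb N Nb pp P : ℝ → ℝ → ℝ}
    (hr : IsSchwRadius M r) (hsol : IsLinSolution M r W Wb N Nb pp P) (u v : ℝ) :
    pdu (Gdot M r W Wb N pp P) u v + pdv (Gbdot M r W Wb Nb pp P) u v = 0 := by
  obtain ⟨hrs, hrgt, hrv, hru⟩ := hr
  obtain ⟨hW, hWb, hN, hNb, hpp, hP, eWv, eWbu, eWbv, eWu, eNbv, eNu, eppu, eppv, ePv, ePu⟩ := hsol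
  have hr0 : ∀ u v, r u v ≠ 0 := fun u v => ((mul_pos two_pos hM).trans (hrgt u v)).ne'
  have hrM : ∀ u v, r u v - 2 * M ≠ 0 := fun u v => (sub_pos.2 (hrgt u v)).ne'
  have top_ne : ((⊤ : ℕ∞) : WithTop ℕ∞) ≠ 0 := by simp
  have ru := hasDerivAt_pdu (hrs.differentiable top_ne) u v
  have rv := hasDerivAt_pdv (hrs.differentiable top_ne) u v
  have hG := HasDerivAt.fluxPoly (M := M) ru (ru.fun_inv (hr0 u v))
    (hasDerivAt_pdu (hW.differentiable top_ne) u v)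
    (hasDerivAt_pdu (hWb.differentiable top_ne) u v)
    (hasDerivAt_pdu (hN.differentiable top_ne) u v)
    (hasDerivAt_pdu (hpp.differentiable top_ne) u v)
    (hasDerivAt_pdu (hP.differentiable top_ne) u v)
  have hGb := HasDerivAt.fluxPoly (M := M) rv (rv.fun_inv (hr0 u v))
    (hasDerivAt_pdv (hWb.differentiable top_ne) u v)
    (hasDerivAt_pdv (hW.differentiable top_ne) u v)
    (hasDerivAt_pdv (hNb.differentiable top_ne) u v)
    (hasDerivAt_pdv (hpp.differentiable top_ne) u v).fun_neg
    (hasDerivAt_pdv (hP.differentiable top_ne) u v)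
  simp only [Gbdot_eq_Gdot]
  simp only [pdu, pdv, Gdot_eq_fluxPoly _ _ _ _ _ (hr0 _ _) (hrM _ _)]
  rw [hG.deriv, hGb.deriv]
  simp only [hrv, hru, eWv, eWbu, eWbv, eWu, eNbv, eNu, eppu, eppv, ePv, ePu, kap, om, rho, Om2]
  have := hr0 u v
  field_simp
  ring

/-- Spherically symmetric case of the conservation law (1.21) of Theorem 1.5 on a
characteristic rectangle: `Ḟ_{u₁} + Ḟ̲_{v₁} = Ḟ_{u₀} + Ḟ̲_{v₀}`. -/
theorem teukolsky_flux_conservation_law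
    (M : ℝ) (hM : 0 < M) (r W Wb N Nb pp P : ℝ → ℝ → ℝ)
    (hr : IsSchwRadius M r) (hsol : IsLinSolution M r W Wb N Nb pp P) :
    ∀ u₀ u₁ v₀ v₁ : ℝ,
      (∫ v in v₀..v₁, Gdot M r W Wb N pp P u₁ v) +
        (∫ u in u₀..u₁, Gbdot M r W Wb Nb pp P u v₁) =
      (∫ v in v₀..v₁, Gdot M r W Wb N pp P u₀ v) +
        (∫ u in u₀..u₁, Gbdot M r W Wb Nb pp P u v₀) := by
  intro u₀ u₁ v₀ v₁
  have hdiv := pdu_Gdot_add_pdv_Gbdot hM hr hsol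
  obtain ⟨hrs, hrgt, -, -⟩ := hr
  obtain ⟨hW, hWb, hN, hNb, hpp, hP, -⟩ := hsol
  have hr0 : ∀ u v, r u v ≠ 0 := fun u v => ((mul_pos two_pos hM).trans (hrgt u v)).ne'
  have hrM : ∀ u v, r u v - 2 * M ≠ 0 := fun u v => (sub_pos.2 (hrgt u v)).ne'
  have hG := contDiff_Gdot hrs hr0 hrM hW hWb hN hpp hP
  have hGb := contDiff_Gdot (pp := fun u v => -pp u v) hrs hr0 hrM hWb hW hNb hpp.neg hP
  rw [← Gbdot_eq_Gdot] at hGb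
  have one_le : (1 : WithTop ℕ∞) ≤ ((⊤ : ℕ∞) : WithTop ℕ∞) := by exact_mod_cast le_top
  exact rectangle_flux_of_divergence_eq_zero (hG.of_le one_le) (hGb.of_le one_le) hdiv u₀ u₁ v₀ v₁
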